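/- Let α be a type and let a, b : α be distinct elements, and let F be the free group on α. Fix integers j, k and set w = (of a)^j * (of b)^k ∈ F. Then w has no trace twins in F: for every element x ∈ F, if there exist nonzero integers m, n such that for every group homomorphism ρ : F → SL₂(ℂ) one has (tr ρ(w^m))² = (tr ρ(x^n))², then there exist nonzero integers m′, n′ such that w^{m′} is conjugate to x^{n′} in F. -/

import Mathlib

namespace TraceTwins

/-- The product of `g * c ^ q` over a list of pairs `(g, q)`. -/
def wp {G : Type*} [Group G] (c : G) (L : List (G × ℤ)) : G :=
  (L.map fun p => p.1 * c ^ p.2).prod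

lemma wp_nil {G : Type*} [Group G] (c : G) : wp c [] = 1 := rfl

lemma wp_cons {G : Type*} [Group G] (c : G) (p : G × ℤ) (L : List (G × ℤ)) :
    wp c (p :: L) = p.1 * c ^ p.2 * wp c L := by simp [wp]

lemma wp_append {G : Type*} [Group G] (c : G) (L L' : List (G × ℤ)) :
    wp c (L ++ L') = wp c L * wp c L' := by simp [wp]

lemma isConj_mul_comm {G : Type*} [Group G] (x y : G) : IsConj (x * y) (y * x) := by
  rw [isConj_iff]
  exact ⟨x⁻¹, by group⟩

lemma exists_list_inv {G : Type*} [Group G] (H : Subgroup G) (c : G) (L : List (G × ℤ))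
    (hL : ∀ p ∈ L, p.1 ∈ H) :
    ∃ L' : List (G × ℤ), (∀ p ∈ L', p.1 ∈ H) ∧ (wp c L)⁻¹ = wp c L' := by
  induction L with
  | nil => exact ⟨[], by simp, by simp [wp]⟩
  | cons p L ih =>
    obtain ⟨L', h1, h2⟩ := ih (fun p hp => hL p (List.mem_cons_of_mem _ hp))
    have hp := hL p List.mem_cons_self
    refine ⟨L' ++ [(1, -p.2), (p.1⁻¹, 0)], ?_, ?_⟩
    · intro q hq
      simp only [List.mem_append, List.mem_cons, List.not_mem_nil, or_false] at hq
      rcases hq with hq | rfl | rfl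
      · exact h1 q hq
      · exact H.one_mem
      · exact H.inv_mem hp
    · rw [wp_cons, wp_append, mul_inv_rev, h2]
      simp [wp]

lemma exists_list {G : Type*} [Group G] (H : Subgroup G) (c : G) (x : G)
    (hx : x ∈ Subgroup.closure ((H : Set G) ∪ {c})) :
    ∃ L : List (G × ℤ), (∀ p ∈ L, p.1 ∈ H) ∧ x = wp c L := by
  induction hx using Subgroup.closure_induction with
  | mem y hy =>
    rcases hy with hy | hy
    · exact ⟨[(y, 0)], by simpa using hy, by simp [wp]⟩
    · exact ⟨[(1, 1)], by simp [H.one_mem], by simpa [wp] using hy⟩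
  | one => exact ⟨[], by simp, by simp [wp]⟩
  | mul y z _ _ h1 h2 =>
    obtain ⟨L, h1, rfl⟩ := h1
    obtain ⟨L', h2, rfl⟩ := h2
    refine ⟨L ++ L', ?_, (wp_append _ _ _).symm⟩
    intro p hp
    rcases List.mem_append.1 hp with h | h
    · exact h1 p h
    · exact h2 p h
  | inv y _ h =>
    obtain ⟨L, h1, rfl⟩ := h
    exact exists_list_inv H c L h1

lemma normal_form_aux {G : Type*} [Group G] (H : Subgroup G) (c : G) (n : ℕ) :
    ∀ L : List (G × ℤ), L.length = n → (∀ p ∈ L, p.1 ∈ H) →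
    (∃ h ∈ H, IsConj (wp c L) h) ∨ (∃ q : ℤ, q ≠ 0 ∧ IsConj (wp c L) (c ^ q)) ∨
    ∃ L' : List (G × ℤ), L' ≠ [] ∧ (∀ p ∈ L', p.1 ∈ H ∧ p.1 ≠ 1 ∧ p.2 ≠ 0) ∧
      IsConj (wp c L) (wp c L') := by
  induction n using Nat.strong_induction_on with
  | _ n ih =>
  intro L hn hL
  by_cases hnil : L = []
  · left
    exact ⟨1, H.one_mem, by rw [hnil, wp_nil]⟩
  by_cases hgood : ∀ p ∈ L, p.1 ≠ 1 ∧ p.2 ≠ 0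
  · right; right
    exact ⟨L, hnil, fun p hp => ⟨hL p hp, hgood p hp⟩, IsConj.refl _⟩
  push Not at hgood
  obtain ⟨⟨g, q⟩, hp, hbad⟩ := hgood
  obtain ⟨s, t, rfl⟩ := List.append_of_mem hp
  have hg : g ∈ H := hL _ hp
  have hc : IsConj (wp c (s ++ (g, q) :: t)) (g * c ^ q * wp c (t ++ s)) := by
    have h := isConj_mul_comm (wp c s) (g * c ^ q * wp c t)
    rw [wp_append, wp_cons, wp_append]
    simpa [mul_assoc] using h
  have hr : ∀ p ∈ t ++ s, p.1 ∈ H := by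
    intro p hp
    apply hL
    simp only [List.mem_append, List.mem_cons] at hp ⊢
    tauto
  have hlen : (t ++ s).length + 1 = n := by
    rw [← hn]; simp; omega
  generalize t ++ s = r at hc hr hlen
  suffices hs : ∀ y : G, IsConj y (g * c ^ q * wp c r) →
      (∃ h ∈ H, IsConj y h) ∨ (∃ q : ℤ, q ≠ 0 ∧ IsConj y (c ^ q)) ∨
      ∃ L' : List (G × ℤ), L' ≠ [] ∧ (∀ p ∈ L', p.1 ∈ H ∧ p.1 ≠ 1 ∧ p.2 ≠ 0) ∧
      IsConj y (wp c L') from hs _ hc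
  clear hc
  intro y hy
  have key : ∀ L1 : List (G × ℤ), L1.length < n → (∀ p ∈ L1, p.1 ∈ H) →
      IsConj y (wp c L1) → (∃ h ∈ H, IsConj y h) ∨ (∃ q : ℤ, q ≠ 0 ∧ IsConj y (c ^ q)) ∨
      ∃ L' : List (G × ℤ), L' ≠ [] ∧ (∀ p ∈ L', p.1 ∈ H ∧ p.1 ≠ 1 ∧ p.2 ≠ 0) ∧
      IsConj y (wp c L') := by
    intro L1 h1 h2 h3
    rcases ih _ h1 L1 rfl h2 with ⟨h, hh, h4⟩ | ⟨q, hq, h4⟩ | ⟨L', h5, h6, h7⟩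
    · exact Or.inl ⟨h, hh, h3.trans h4⟩
    · exact Or.inr (Or.inl ⟨q, hq, h3.trans h4⟩)
    · exact Or.inr (Or.inr ⟨L', h5, h6, h3.trans h7⟩)
  by_cases hq : q = 0
  · subst hq
    rw [zpow_zero, mul_one] at hy
    cases r with
    | nil => exact Or.inl ⟨g, hg, by simpa [wp] using hy⟩
    | cons p r =>
      refine key ((g * p.1, p.2) :: r) ?_ ?_ ?_
      · simp only [List.length_cons] at hlen ⊢; omega
      · intro p' hp'
        rcases List.mem_cons.1 hp' with rfl | h
        · exact H.mul_mem hg (hr p List.mem_cons_self)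
        · exact hr p' (List.mem_cons_of_mem _ h)
      · rw [wp_cons] at hy ⊢
        simpa [mul_assoc] using hy
  · have hg1 : g = 1 := by
      by_contra h
      exact hq (hbad h)
    subst hg1
    rw [one_mul] at hy
    rcases List.eq_nil_or_concat r with rfl | ⟨r', p, rfl⟩
    · exact Or.inr (Or.inl ⟨q, hq, by simpa [wp] using hy⟩)
    · rw [List.concat_eq_append] at *
      refine key (r' ++ [(p.1, p.2 + q)]) ?_ ?_ ?_
      · simp only [List.length_append, List.length_cons, List.length_nil] at hlen ⊢; omega
      · intro p' hp'
        rcases List.mem_append.1 hp' with h | h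
        · exact hr p' (List.mem_append_left _ h)
        · rw [List.mem_singleton] at h
          subst h
          exact hr p (by simp)
      · have := hy.trans (isConj_mul_comm _ _)
        rw [wp_append] at this ⊢
        simpa [wp, mul_assoc, zpow_add] using this

lemma normal_form {G : Type*} [Group G] (H : Subgroup G) (c : G) (x : G)
    (hx : x ∈ Subgroup.closure ((H : Set G) ∪ {c})) :
    (∃ h ∈ H, IsConj x h) ∨ (∃ q : ℤ, q ≠ 0 ∧ IsConj x (c ^ q)) ∨
    ∃ L' : List (G × ℤ), L' ≠ [] ∧ (∀ p ∈ L', p.1 ∈ H ∧ p.1 ≠ 1 ∧ p.2 ≠ 0) ∧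
      IsConj x (wp c L') := by
  obtain ⟨L, h1, rfl⟩ := exists_list H c x hx
  exact normal_form_aux H c _ L rfl h1

/-! ### A Schottky representation -/

/-- Centre of the disc attached to a letter. -/
def ctr {α : Type*} (f : α → ℕ) (l : α × Bool) : ℂ :=
  8 * (f l.1 : ℂ) + (if l.2 then 6 else 2)

/-- Schottky generator with discs of radius one centred at `p` and `q`. -/
def schottky (p q : ℂ) : Matrix.SpecialLinearGroup (Fin 2) ℂ :=
  ⟨!![p, -(p * q) - 1; 1, -q], by rw [Matrix.det_fin_two_of]; ring⟩

lemma schottky_inv (p q : ℂ) : ((schottky p q)⁻¹ : Matrix.SpecialLinearGroup (Fin 2) ℂ).1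
    = - (schottky q p).1 := by
  rw [Matrix.SpecialLinearGroup.SL2_inv_expl]
  ext i j
  fin_cases i <;> fin_cases j <;> simp [schottky] <;> ring

/-- The representation. -/
noncomputable def srep {α : Type*} (f : α → ℕ) :
    FreeGroup α →* Matrix.SpecialLinearGroup (Fin 2) ℂ :=
  FreeGroup.lift fun c => schottky (ctr f (c, true)) (ctr f (c, false))

/-- In the disc of radius one centred at `z`. -/
def InD (z : ℂ) (v : Fin 2 → ℂ) : Prop := ‖v 0 - z * v 1‖ < ‖v 1‖

/-- Outside the disc of radius one centred at `z`. -/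
def OutD (z : ℂ) (v : Fin 2 → ℂ) : Prop := ‖v 1‖ < ‖v 0 - z * v 1‖

lemma schottky_inD (p q : ℂ) (v : Fin 2 → ℂ) (hv : OutD q v) :
    InD p ((schottky p q).1.mulVec v) := by
  unfold InD OutD at *
  have h0 : ((schottky p q).1.mulVec v) 0 = p * v 0 + (-(p * q) - 1) * v 1 := by
    simp [schottky, Matrix.mulVec, dotProduct, Fin.sum_univ_two]
  have h1 : ((schottky p q).1.mulVec v) 1 = v 0 - q * v 1 := by
    simp [schottky, Matrix.mulVec, dotProduct, Fin.sum_univ_two]; ring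
  rw [h0, h1]
  have : p * v 0 + (-(p * q) - 1) * v 1 - p * (v 0 - q * v 1) = - v 1 := by ring
  rw [this, norm_neg]
  exact hv

lemma inD_outD (z z' : ℂ) (hz : 4 ≤ ‖z - z'‖) (v : Fin 2 → ℂ) (hv : InD z v) : OutD z' v := by
  unfold InD OutD at *
  have h1 : 0 < ‖v 1‖ := lt_of_le_of_lt (norm_nonneg _) hv
  have h2 : ‖(z - z') * v 1‖ ≤ ‖v 0 - z' * v 1‖ + ‖v 0 - z * v 1‖ := by
    have : (z - z') * v 1 = (v 0 - z' * v 1) - (v 0 - z * v 1) := by ring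
    rw [this]
    exact norm_sub_le _ _
  rw [norm_mul] at h2
  nlinarith

lemma ctr_dist {α : Type*} (f : α → ℕ) (l l' : α × Bool) (hf : f l.1 = f l'.1 → l.1 = l'.1)
    (h : l ≠ l') : 4 ≤ ‖ctr f l - ctr f l'‖ := by
  obtain ⟨c, e⟩ := l
  obtain ⟨c', e'⟩ := l'
  have key : ∃ z : ℤ, ctr f (c, e) - ctr f (c', e') = ((4 * z : ℤ) : ℂ) ∧ z ≠ 0 := by
    refine ⟨2 * ((f c : ℤ) - f c') + ((if e then 1 else 0) - (if e' then 1 else 0)), ?_, ?_⟩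
    · unfold ctr
      cases e <;> cases e' <;> simp <;> ring
    · intro h0
      apply h
      have : f c = f c' ∧ e = e' := by
        cases e <;> cases e' <;> simp at h0 ⊢ <;> omega
      exact Prod.ext (hf this.1) this.2
  obtain ⟨z, h1, h2⟩ := key
  rw [h1, Complex.norm_intCast]
  have : (1 : ℤ) ≤ |z| := Int.one_le_abs h2
  have h4 : (4 : ℤ) ≤ |4 * z| := by rw [abs_mul]; norm_num; omega
  exact_mod_cast h4

lemma ctr_norm {α : Type*} (f : α → ℕ) (l : α × Bool) : 2 ≤ ‖ctr f l‖ := by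
  have : ctr f l = ((8 * f l.1 + (if l.2 then 6 else 2) : ℕ) : ℂ) := by
    unfold ctr; split_ifs <;> simp
  rw [this, Complex.norm_natCast]
  have : 2 ≤ 8 * f l.1 + (if l.2 then 6 else 2) := by split_ifs <;> omega
  exact_mod_cast this

lemma letter_inD {α : Type*} (f : α → ℕ) (l : α × Bool) (v : Fin 2 → ℂ)
    (hv : OutD (ctr f (l.1, !l.2)) v) :
    InD (ctr f l) ((srep f (FreeGroup.mk [l])).1.mulVec v) := by
  obtain ⟨c, e⟩ := l
  cases e
  · have : (srep f (FreeGroup.mk [(c, false)])).1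
      = - (schottky (ctr f (c, false)) (ctr f (c, true))).1 := by
      rw [← schottky_inv]
      simp [srep]
    rw [this, Matrix.neg_mulVec]
    have h := schottky_inD (ctr f (c, false)) (ctr f (c, true)) v hv
    unfold InD at h ⊢
    simp only [Pi.neg_apply, norm_neg]
    rw [show ∀ a b z : ℂ, -a - z * -b = -(a - z * b) by intros; ring, norm_neg]
    simpa using h
  · have : (srep f (FreeGroup.mk [(c, true)])).1
      = (schottky (ctr f (c, true)) (ctr f (c, false))).1 := by
      simp [srep]
    rw [this]
    exact schottky_inD _ _ v hv

lemma word_inD {α : Type*} (f : α → ℕ) (v : Fin 2 → ℂ)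
    (hv : ∀ l, OutD (ctr f l) v) (L : List (α × Bool)) :
    ∀ l : α × Bool, FreeGroup.IsReduced (l :: L) →
    Set.InjOn f {c | ∃ l' ∈ l :: L, l'.1 = c} →
    InD (ctr f l) ((srep f (FreeGroup.mk (l :: L))).1.mulVec v) := by
  induction L with
  | nil =>
    intro l _ _
    exact letter_inD f l v (hv _)
  | cons l' L ih =>
    intro l hred hf
    rw [FreeGroup.isReduced_cons_cons] at hred
    have h1 := ih l' hred.2 (hf.mono (by
      rintro c ⟨l'', h, rfl⟩
      exact ⟨l'', List.mem_cons_of_mem _ h, rfl⟩))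
    have h2 : FreeGroup.mk (l :: l' :: L) = FreeGroup.mk [l] * FreeGroup.mk (l' :: L) := by
      rw [FreeGroup.mul_mk]; rfl
    rw [h2, map_mul, Matrix.SpecialLinearGroup.coe_mul, ← Matrix.mulVec_mulVec]
    apply letter_inD
    refine inD_outD _ _ (ctr_dist f _ _ ?_ ?_) _ h1
    · intro h
      exact hf ⟨l', by simp, rfl⟩ ⟨l, by simp, rfl⟩ h
    · intro h
      have h3 := hred.1 (by rw [h])
      rw [h] at h3
      simp at h3

lemma exists_rep {α : Type*} (gs : List (FreeGroup α)) :
    ∃ ρ : FreeGroup α →* Matrix.SpecialLinearGroup (Fin 2) ℂ,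
      ∀ g ∈ gs, g ≠ 1 → ∀ i j, (ρ g).1 i j ≠ 0 := by
  classical
  have hfin : (⋃ g ∈ {g | g ∈ gs}, {c | ∃ l' ∈ g.toWord, l'.1 = c}).Finite := by
    apply Set.Finite.biUnion
    · exact List.finite_toSet gs
    · intro g _
      exact ((List.finite_toSet g.toWord).image Prod.fst).subset (by
        rintro c ⟨l, h, rfl⟩
        exact ⟨l, h, rfl⟩)
  obtain ⟨f, hf⟩ := Set.countable_iff_exists_injOn.1 hfin.countable
  refine ⟨srep f, fun g hg hg1 => ?_⟩
  have hcol : ∀ v : Fin 2 → ℂ, (∀ l : α × Bool, OutD (ctr f l) v) →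
      ∀ i, ((srep f g).1.mulVec v) i ≠ 0 := by
    intro v hv
    have hne : g.toWord ≠ [] := by rwa [Ne, FreeGroup.toWord_eq_nil_iff]
    obtain ⟨l, L, hL⟩ := List.exists_cons_of_ne_nil hne
    have h := word_inD f v hv L l (hL ▸ FreeGroup.isReduced_toWord) (hf.mono (by
      rw [← hL]
      intro c hc
      simp only [Set.mem_iUnion]
      exact ⟨g, hg, hc⟩))
    rw [← hL, FreeGroup.mk_toWord] at h
    generalize (srep f g).1.mulVec v = u at h
    unfold InD at h
    have h1 : 0 < ‖u 1‖ := lt_of_le_of_lt (norm_nonneg _) h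
    have h2 := ctr_norm f l
    have : ∀ i : Fin 2, i = 0 ∨ i = 1 := by decide
    intro i
    rcases this i with rfl | rfl
    · intro h0
      rw [h0, zero_sub, norm_neg, norm_mul] at h
      nlinarith
    · exact norm_pos_iff.1 h1
  intro i j
  have h3 := hcol (Pi.single j 1) (by
    intro l
    have h2 := ctr_norm f l
    have : ∀ i : Fin 2, i = 0 ∨ i = 1 := by decide
    rcases this j with rfl | rfl
    · simp [OutD]
    · simp [OutD]; linarith) i
  simpa using h3


/-! ### Growth of traces -/

/-- Diagonal matrices. -/
noncomputable def dg0 (μ : ℂˣ) : Matrix.SpecialLinearGroup (Fin 2) ℂ :=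
  ⟨!![(μ : ℂ), 0; 0, ((μ⁻¹ : ℂˣ) : ℂ)], by simp [Matrix.det_fin_two_of]⟩

lemma dg0_coe (μ : ℂˣ) : (dg0 μ).1 = !![(μ : ℂ), 0; 0, ((μ⁻¹ : ℂˣ) : ℂ)] := rfl

/-- Diagonal matrices as a homomorphism. -/
noncomputable def dg : ℂˣ →* Matrix.SpecialLinearGroup (Fin 2) ℂ where
  toFun := dg0
  map_one' := by
    apply Subtype.ext
    rw [dg0_coe, Matrix.SpecialLinearGroup.coe_one, Matrix.one_fin_two]
    simp
  map_mul' x y := by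
    apply Subtype.ext
    rw [Matrix.SpecialLinearGroup.coe_mul, dg0_coe, dg0_coe, dg0_coe]
    simp [Matrix.mul_fin_two, mul_comm]

lemma dg_coe (μ : ℂˣ) : (dg μ).1 = !![(μ : ℂ), 0; 0, ((μ⁻¹ : ℂˣ) : ℂ)] := rfl

/-- The subgroup generated by the generators other than `c`. -/
def Hc {α : Type*} (c : α) : Subgroup (FreeGroup α) :=
  Subgroup.closure (FreeGroup.of '' {d | d ≠ c})

open Classical in
/-- Replace the value at `c` by a diagonal matrix. -/
noncomputable def rep {α : Type*} (ρ : FreeGroup α →* Matrix.SpecialLinearGroup (Fin 2) ℂ)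
    (c : α) (μ : ℂˣ) : FreeGroup α →* Matrix.SpecialLinearGroup (Fin 2) ℂ :=
  FreeGroup.lift fun d => if d = c then dg μ else ρ (FreeGroup.of d)

lemma rep_c {α : Type*} (ρ : FreeGroup α →* Matrix.SpecialLinearGroup (Fin 2) ℂ)
    (c : α) (μ : ℂˣ) : rep ρ c μ (FreeGroup.of c) = dg μ := by
  simp [rep]

lemma rep_mem {α : Type*} (ρ : FreeGroup α →* Matrix.SpecialLinearGroup (Fin 2) ℂ)
    (c : α) (μ : ℂˣ) (h : FreeGroup α) (hh : h ∈ Hc c) : rep ρ c μ h = ρ h := by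
  have : Hc c ≤ MonoidHom.eqLocus (rep ρ c μ) ρ := by
    unfold Hc
    rw [Subgroup.closure_le]
    rintro _ ⟨d, hd, rfl⟩
    have hd' : d ≠ c := hd
    change rep ρ c μ (FreeGroup.of d) = ρ (FreeGroup.of d)
    simp [rep, hd']
  exact this hh

/-- The trace of `x` along the family `rep ρ c (1/ε)` is `ε^{-N} (g + o(1))`. -/
def HasGrowth {α : Type*} (ρ : FreeGroup α →* Matrix.SpecialLinearGroup (Fin 2) ℂ)
    (c : α) (x : FreeGroup α) (N : ℕ) (g : ℂ) : Prop :=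
  ∃ G : ℂ → ℂ, Continuous G ∧ G 0 = g ∧
    ∀ ε : ℂˣ, G ε = (ε : ℂ) ^ N * Matrix.trace (rep ρ c ε⁻¹ x).1

lemma eq_at_zero (f g : ℂ → ℂ) (hf : Continuous f) (hg : Continuous g)
    (h : ∀ ε : ℂˣ, f ε = g ε) : f 0 = g 0 := by
  have : f = g := by
    refine Continuous.ext_on (s := {0}ᶜ) (dense_compl_singleton 0) hf hg ?_
    intro z hz
    exact h (Units.mk0 z hz)
  rw [this]

lemma growth_le {α : Type*} (ρ : FreeGroup α →* Matrix.SpecialLinearGroup (Fin 2) ℂ)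
    (c : α) (x y : FreeGroup α) (N M : ℕ) (g g' : ℂ) (hx : HasGrowth ρ c x N g)
    (hy : HasGrowth ρ c y M g')
    (h : ∀ ρ : FreeGroup α →* Matrix.SpecialLinearGroup (Fin 2) ℂ,
      Matrix.trace (ρ x).1 ^ 2 = Matrix.trace (ρ y).1 ^ 2) (hg : g ≠ 0) : N ≤ M := by
  obtain ⟨G, h1, h2, h3⟩ := hx
  obtain ⟨G', h1', h2', h3'⟩ := hy
  by_contra hlt
  push Not at hlt
  obtain ⟨d, rfl⟩ := Nat.exists_eq_add_of_lt hlt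
  have := eq_at_zero (fun ε => G ε ^ 2) (fun ε => ε ^ (2 * (d + 1)) * G' ε ^ 2)
    (by fun_prop) (by fun_prop) (by
      intro ε
      have := h (rep ρ c ε⁻¹)
      simp only [h3, h3', mul_pow, this]
      ring)
  simp [h2] at this
  exact hg this

lemma growth_eq {α : Type*} (ρ : FreeGroup α →* Matrix.SpecialLinearGroup (Fin 2) ℂ)
    (c : α) (x y : FreeGroup α) (N : ℕ) (g g' : ℂ) (hx : HasGrowth ρ c x N g)
    (hy : HasGrowth ρ c y N g')
    (h : ∀ ρ : FreeGroup α →* Matrix.SpecialLinearGroup (Fin 2) ℂ,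
      Matrix.trace (ρ x).1 ^ 2 = Matrix.trace (ρ y).1 ^ 2) : g ^ 2 = g' ^ 2 := by
  obtain ⟨G, h1, h2, h3⟩ := hx
  obtain ⟨G', h1', h2', h3'⟩ := hy
  have := eq_at_zero (fun ε => G ε ^ 2) (fun ε => G' ε ^ 2)
    (by fun_prop) (by fun_prop) (by
      intro ε
      have := h (rep ρ c ε⁻¹)
      simp only [h3, h3', mul_pow, this])
  simpa [h2, h2'] using this

lemma growth_mem {α : Type*} (ρ : FreeGroup α →* Matrix.SpecialLinearGroup (Fin 2) ℂ)
    (c : α) (x : FreeGroup α) (hx : x ∈ Hc c) : HasGrowth ρ c x 0 (Matrix.trace (ρ x).1) := by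
  refine ⟨fun _ => Matrix.trace (ρ x).1, continuous_const, rfl, ?_⟩
  intro ε
  rw [rep_mem _ _ _ _ hx]
  simp

/-- Normalised diagonal matrix. -/
def EE (q : ℤ) (ε : ℂ) : Matrix (Fin 2) (Fin 2) ℂ :=
  if 0 < q then !![1, 0; 0, ε ^ (2 * q.natAbs)] else !![ε ^ (2 * q.natAbs), 0; 0, 1]

/-- Index of the dominant eigenvalue. -/
def sg (q : ℤ) : Fin 2 := if 0 < q then 0 else 1

lemma EE_eq (q : ℤ) (ε : ℂˣ) : EE q ε = (ε : ℂ) ^ q.natAbs • (dg ε⁻¹ ^ q).1 := by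
  rw [← map_zpow, dg_coe]
  have hε : (ε : ℂ) ≠ 0 := ε.ne_zero
  unfold EE
  rcases Int.natAbs_eq q with h | h <;> generalize q.natAbs = n at h <;> subst h
  · split_ifs with h0
    · ext i j
      fin_cases i <;> fin_cases j <;> simp [hε, two_mul, pow_add]
    · have : n = 0 := by omega
      subst this
      ext i j
      fin_cases i <;> fin_cases j <;> simp
  · rw [if_neg (by omega)]
    ext i j
    fin_cases i <;> fin_cases j <;> simp [hε, two_mul, pow_add]

lemma EE_continuous (q : ℤ) : Continuous (EE q) := by
  unfold EE
  split_ifs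
  · refine continuous_matrix ?_
    intro i j
    fin_cases i <;> fin_cases j <;> simp <;> fun_prop
  · refine continuous_matrix ?_
    intro i j
    fin_cases i <;> fin_cases j <;> simp <;> fun_prop

lemma EE_zero (q : ℤ) (hq : q ≠ 0) (i j : Fin 2) :
    EE q 0 i j = if i = sg q ∧ j = sg q then 1 else 0 := by
  unfold EE sg
  split_ifs with h <;> fin_cases i <;> fin_cases j <;> simp_all

section lists
variable {α : Type*}

/-- Normalised matrix product. -/
noncomputable def XL (ρ : FreeGroup α →* Matrix.SpecialLinearGroup (Fin 2) ℂ)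
    (L : List (FreeGroup α × ℤ)) (ε : ℂ) : Matrix (Fin 2) (Fin 2) ℂ :=
  (L.map fun p => (ρ p.1).1 * EE p.2 ε).prod

/-- Total weight. -/
def wt (L : List (FreeGroup α × ℤ)) : ℕ := (L.map fun p => p.2.natAbs).sum

/-- Product of the entries along the list. -/
noncomputable def coef (ρ : FreeGroup α →* Matrix.SpecialLinearGroup (Fin 2) ℂ) :
    Fin 2 → List (FreeGroup α × ℤ) → ℂ
  | _, [] => 1
  | τ, p :: L => (ρ p.1).1 τ (sg p.2) * coef ρ (sg p.2) L

/-- Last index. -/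
def lst : Fin 2 → List (FreeGroup α × ℤ) → Fin 2
  | τ, [] => τ
  | _, p :: L => lst (sg p.2) L

lemma lst_indep (τ τ' : Fin 2) (L : List (FreeGroup α × ℤ)) (hL : L ≠ []) :
    lst τ L = lst τ' L := by
  cases L with
  | nil => exact absurd rfl hL
  | cons p L => rfl

lemma XL_continuous (ρ : FreeGroup α →* Matrix.SpecialLinearGroup (Fin 2) ℂ)
    (L : List (FreeGroup α × ℤ)) : Continuous (XL ρ L) := by
  induction L with
  | nil => exact continuous_const
  | cons p L ih =>
    have : XL ρ (p :: L) = fun ε => (ρ p.1).1 * EE p.2 ε * XL ρ L ε := by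
      ext1 ε; simp [XL]
    rw [this]
    exact (continuous_const.mul (EE_continuous _)).mul ih

lemma XL_zero (ρ : FreeGroup α →* Matrix.SpecialLinearGroup (Fin 2) ℂ)
    (L : List (FreeGroup α × ℤ)) (hL : ∀ p ∈ L, p.2 ≠ 0) : ∀ τ υ : Fin 2,
    XL ρ L 0 τ υ = if υ = lst τ L then coef ρ τ L else 0 := by
  induction L with
  | nil =>
    intro τ υ
    simp [XL, lst, coef, Matrix.one_apply, eq_comm]
  | cons p L ih =>
    intro τ υ
    have hp := hL p List.mem_cons_self
    have h1 := ih (fun p hp => hL p (List.mem_cons_of_mem _ hp))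
    have : XL ρ (p :: L) 0 = (ρ p.1).1 * (EE p.2 0 * XL ρ L 0) := by
      simp [XL, mul_assoc]
    rw [this, Matrix.mul_apply]
    have h2 : ∀ i, (EE p.2 0 * XL ρ L 0) i υ = if i = sg p.2 then XL ρ L 0 (sg p.2) υ else 0 := by
      intro i
      rw [Matrix.mul_apply]
      simp only [EE_zero _ hp]
      split_ifs with h <;> simp [h]
    simp only [h2]
    by_cases h : υ = lst (sg p.2) L
    · simp [h1, lst, coef, h]
    · simp [h1, lst, coef, h]

lemma XL_eq (ρ : FreeGroup α →* Matrix.SpecialLinearGroup (Fin 2) ℂ) (c : α)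
    (L : List (FreeGroup α × ℤ)) (hL : ∀ p ∈ L, p.1 ∈ Hc c) (ε : ℂˣ) :
    XL ρ L ε = (ε : ℂ) ^ wt L • (rep ρ c ε⁻¹ (wp (FreeGroup.of c) L)).1 := by
  induction L with
  | nil => simp [XL, wt, wp]
  | cons p L ih =>
    have h1 := ih (fun p hp => hL p (List.mem_cons_of_mem _ hp))
    have : XL ρ (p :: L) ε = (ρ p.1).1 * EE p.2 ε * XL ρ L ε := by
      simp [XL]
    rw [this, h1, EE_eq, wp_cons, map_mul, map_mul, map_zpow, rep_c,
      rep_mem _ _ _ _ (hL p List.mem_cons_self), Matrix.SpecialLinearGroup.coe_mul,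
      Matrix.SpecialLinearGroup.coe_mul]
    simp [wt, pow_add, mul_smul]
    rw [smul_comm]

lemma growth_list (ρ : FreeGroup α →* Matrix.SpecialLinearGroup (Fin 2) ℂ) (c : α)
    (L : List (FreeGroup α × ℤ)) (hne : L ≠ []) (hL : ∀ p ∈ L, p.1 ∈ Hc c)
    (hq : ∀ p ∈ L, p.2 ≠ 0) (n : ℕ) (hn : n ≠ 0) :
    HasGrowth ρ c (wp (FreeGroup.of c) L ^ n) (wt L * n) (coef ρ (lst 0 L) L ^ n) := by
  refine ⟨fun ε => Matrix.trace (XL ρ L ε ^ n), ?_, ?_, ?_⟩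
  · exact ((XL_continuous ρ L).pow n).matrix_trace
  · obtain ⟨n, rfl⟩ := Nat.exists_eq_succ_of_ne_zero hn
    set s := lst 0 L with hs
    have hX : ∀ τ υ, XL ρ L 0 τ υ = if υ = s then coef ρ τ L else 0 := by
      intro τ υ
      rw [XL_zero ρ L hq, lst_indep τ 0 L hne]
    have hsq : XL ρ L 0 * XL ρ L 0 = coef ρ s L • XL ρ L 0 := by
      ext τ υ
      rw [Matrix.mul_apply, Matrix.smul_apply]
      simp only [hX]
      split_ifs <;> simp [mul_comm]
    have hpow : ∀ n : ℕ, XL ρ L 0 ^ (n + 1) = coef ρ s L ^ n • XL ρ L 0 := by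
      intro n
      induction n with
      | zero => simp
      | succ n ih => rw [pow_succ, ih, Matrix.smul_mul, hsq, smul_smul, pow_succ]
    change Matrix.trace (XL ρ L 0 ^ (n + 1)) = _
    rw [hpow, Matrix.trace_smul]
    simp [Matrix.trace, hX, pow_succ]
  · intro ε
    change Matrix.trace (XL ρ L ε ^ n) = _
    rw [XL_eq ρ c L hL, smul_pow, Matrix.trace_smul, map_pow, Matrix.SpecialLinearGroup.coe_pow,
      pow_mul, smul_eq_mul]

lemma coef_ne_zero (ρ : FreeGroup α →* Matrix.SpecialLinearGroup (Fin 2) ℂ)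
    (L : List (FreeGroup α × ℤ)) (h : ∀ p ∈ L, ∀ i j, (ρ p.1).1 i j ≠ 0) :
    ∀ τ, coef ρ τ L ≠ 0 := by
  induction L with
  | nil => intro τ; simp [coef]
  | cons p L ih =>
    intro τ
    rw [coef]
    exact mul_ne_zero (h p List.mem_cons_self _ _)
      (ih (fun p hp => h p (List.mem_cons_of_mem _ hp)) _)

lemma coef_noflip (ρ : FreeGroup α →* Matrix.SpecialLinearGroup (Fin 2) ℂ)
    (L : List (FreeGroup α × ℤ)) (h : ∀ p ∈ L, ∀ i j, i ≠ j → (ρ p.1).1 i j = 0) :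
    ∀ τ, coef ρ τ L ≠ 0 → ∀ p ∈ L, sg p.2 = τ := by
  induction L with
  | nil => intro τ; simp
  | cons p L ih =>
    intro τ hc
    rw [coef] at hc
    have h1 : sg p.2 = τ := by
      by_contra hne
      exact left_ne_zero_of_mul hc (h p List.mem_cons_self _ _ (Ne.symm hne))
    have h2 := ih (fun p hp => h p (List.mem_cons_of_mem _ hp)) _ (right_ne_zero_of_mul hc)
    intro p' hp'
    rcases List.mem_cons.1 hp' with rfl | hp'
    · exact h1
    · rw [h2 p' hp', h1]

lemma coef_entry (ρ : FreeGroup α →* Matrix.SpecialLinearGroup (Fin 2) ℂ)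
    (L : List (FreeGroup α × ℤ)) (s : Fin 2) (h : ∀ p ∈ L, sg p.2 = s)
    (hc : coef ρ s L ≠ 0) : ∀ p ∈ L, (ρ p.1).1 s s ≠ 0 := by
  induction L with
  | nil => simp
  | cons p L ih =>
    rw [coef, h p List.mem_cons_self] at hc
    intro p' hp'
    rcases List.mem_cons.1 hp' with rfl | hp'
    · exact left_ne_zero_of_mul hc
    · exact ih (fun p hp => h p (List.mem_cons_of_mem _ hp)) (right_ne_zero_of_mul hc) p' hp'

/-! ### Trace commensurability -/

/-- Trace commensurability with natural exponents. -/
def TC (w x : FreeGroup α) : Prop :=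
  ∃ m n : ℕ, m ≠ 0 ∧ n ≠ 0 ∧ ∀ ρ : FreeGroup α →* Matrix.SpecialLinearGroup (Fin 2) ℂ,
    Matrix.trace (ρ (w ^ m)).1 ^ 2 = Matrix.trace (ρ (x ^ n)).1 ^ 2

lemma trace_inv (g : Matrix.SpecialLinearGroup (Fin 2) ℂ) :
    Matrix.trace (g⁻¹).1 = Matrix.trace g.1 := by
  rw [Matrix.SpecialLinearGroup.SL2_inv_expl]
  rw [Matrix.trace_fin_two, Matrix.trace_fin_two]
  exact add_comm _ _

lemma trace_zpow (ρ : FreeGroup α →* Matrix.SpecialLinearGroup (Fin 2) ℂ) (x : FreeGroup α)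
    (m : ℤ) : Matrix.trace (ρ (x ^ m)).1 = Matrix.trace (ρ (x ^ m.natAbs)).1 := by
  rcases Int.natAbs_eq m with h | h
  · conv_lhs => rw [h, zpow_natCast]
  · conv_lhs => rw [h, zpow_neg, zpow_natCast, map_inv, trace_inv]

lemma TC.symm {w x : FreeGroup α} (h : TC w x) : TC x w := by
  obtain ⟨m, n, hm, hn, h⟩ := h
  exact ⟨n, m, hn, hm, fun ρ => (h ρ).symm⟩

lemma TC.inv {w x : FreeGroup α} (h : TC w x) : TC w⁻¹ x⁻¹ := by
  obtain ⟨m, n, hm, hn, h⟩ := h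
  refine ⟨m, n, hm, hn, fun ρ => ?_⟩
  rw [inv_pow, inv_pow, map_inv, map_inv, trace_inv, trace_inv, h]

lemma TC.conj {w x y : FreeGroup α} (h : TC w x) (hxy : IsConj x y) : TC w y := by
  obtain ⟨m, n, hm, hn, h⟩ := h
  refine ⟨m, n, hm, hn, fun ρ => ?_⟩
  rw [h]
  obtain ⟨c, rfl⟩ := isConj_iff.1 hxy
  rw [conj_pow, map_mul, map_mul, Matrix.SpecialLinearGroup.coe_mul,
    Matrix.SpecialLinearGroup.coe_mul, Matrix.trace_mul_comm, ← mul_assoc,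
    ← Matrix.SpecialLinearGroup.coe_mul, map_inv, inv_mul_cancel]
  simp

lemma no_growth {w : FreeGroup α} (c : α) (hw : w ∈ Hc c)
    (L : List (FreeGroup α × ℤ)) (hne : L ≠ []) (hL : ∀ p ∈ L, p.1 ∈ Hc c)
    (hq : ∀ p ∈ L, p.2 ≠ 0) (h : TC w (wp (FreeGroup.of c) L))
    (ρ : FreeGroup α →* Matrix.SpecialLinearGroup (Fin 2) ℂ)
    (hρ : coef ρ (lst 0 L) L ≠ 0) : False := by
  obtain ⟨m, n, hm, hn, h⟩ := h
  have h1 := growth_list ρ c L hne hL hq n hn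
  have h2 := growth_mem ρ c (w ^ m) (Subgroup.pow_mem _ hw m)
  have h3 := growth_le ρ c _ _ _ _ _ _ h1 h2 (fun ρ => (h ρ).symm) (pow_ne_zero _ hρ)
  have h4 : wt L ≠ 0 := by
    cases L with
    | nil => exact absurd rfl hne
    | cons p L =>
      have := hq p List.mem_cons_self
      simp only [wt, List.map_cons, List.sum_cons]
      omega
  have := Nat.mul_ne_zero h4 hn
  omega

open Classical in
/-- Kill the generator `c`. -/
noncomputable def kill (c : α) : FreeGroup α →* FreeGroup α :=
  FreeGroup.lift fun d => if d = c then 1 else FreeGroup.of d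

lemma kill_self (c : α) : kill c (FreeGroup.of c) = 1 := by simp [kill]

lemma kill_ne {c d : α} (h : d ≠ c) : kill c (FreeGroup.of d) = FreeGroup.of d := by
  simp [kill, h]

lemma kill_mem (c : α) (h : FreeGroup α) (hh : h ∈ Hc c) : kill c h = h := by
  have : Hc c ≤ MonoidHom.eqLocus (kill c) (MonoidHom.id _) := by
    unfold Hc
    rw [Subgroup.closure_le]
    rintro _ ⟨d, hd, rfl⟩
    exact kill_ne hd
  exact this hh

lemma of_mem_Hc {c d : α} (h : d ≠ c) : FreeGroup.of d ∈ Hc c :=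
  Subgroup.subset_closure ⟨d, h, rfl⟩

lemma closure_Hc (c : α) :
    Subgroup.closure ((Hc c : Set (FreeGroup α)) ∪ {FreeGroup.of c}) = ⊤ := by
  rw [eq_top_iff, ← FreeGroup.closure_range_of, Subgroup.closure_le]
  rintro _ ⟨d, rfl⟩
  apply Subgroup.subset_closure
  by_cases h : d = c
  · right; rw [h]; rfl
  · left; exact of_mem_Hc h

lemma conj_kill {w x : FreeGroup α} (c : α) (hw : w ∈ Hc c) (h : TC w x) :
    IsConj x (kill c x) := by
  rcases normal_form (Hc c) (FreeGroup.of c) x (by rw [closure_Hc]; trivial) with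
    ⟨g, hg, hx⟩ | ⟨q, hq, hx⟩ | ⟨L, hL, hp, hx⟩
  · have h1 := (kill c).map_isConj hx
    rw [kill_mem c g hg] at h1
    exact hx.trans h1.symm
  · exfalso
    refine no_growth c hw [(1, q)] (by simp) (by simp) (by simpa using hq)
      (by simpa [wp] using h.conj hx) 1 ?_
    simp [coef, lst]
  · exfalso
    obtain ⟨ρ, hρ⟩ := exists_rep (L.map Prod.fst)
    refine no_growth c hw L hL (fun p h => (hp p h).1) (fun p h => (hp p h).2.2)
      (h.conj hx) ρ (coef_ne_zero ρ L ?_ _)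
    intro p h
    exact hρ p.1 (List.mem_map_of_mem h) (hp p h).2.1

lemma conj_closure_aux {w : FreeGroup α} (T : Set α)
    (hw : w ∈ Subgroup.closure (FreeGroup.of '' T)) (S : Finset α) :
    ∀ x : FreeGroup α, TC w x → x ∈ Subgroup.closure (FreeGroup.of '' (T ∪ S)) →
    ∃ y ∈ Subgroup.closure (FreeGroup.of '' T), IsConj x y := by
  classical
  induction S using Finset.induction_on with
  | empty =>
    intro x _ hx
    exact ⟨x, by simpa using hx, IsConj.refl _⟩
  | insert c S _ ih =>
    intro x h hx
    by_cases hc : c ∈ T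
    · refine ih x h ?_
      have : T ∪ ((insert c S : Finset α) : Set α) = T ∪ S := by
        ext d
        simp only [Set.mem_union, Finset.coe_insert, Set.mem_insert_iff]
        constructor
        · rintro (h | rfl | h) <;> tauto
        · tauto
      rwa [this] at hx
    · have hw' : w ∈ Hc c := by
        refine Subgroup.closure_mono ?_ hw
        apply Set.image_mono
        rintro d hd rfl
        exact hc hd
      have h1 := conj_kill c hw' h
      obtain ⟨y, hy, h2⟩ := ih (kill c x) (h.conj h1) (by
        have : Subgroup.closure (FreeGroup.of '' (T ∪ ((insert c S : Finset α) : Set α))) ≤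
          (Subgroup.closure (FreeGroup.of '' (T ∪ (S : Set α)))).comap (kill c) := by
          rw [Subgroup.closure_le]
          rintro _ ⟨d, hd, rfl⟩
          change kill c (FreeGroup.of d) ∈ Subgroup.closure (FreeGroup.of '' (T ∪ (S : Set α)))
          by_cases hdc : d = c
          · rw [hdc, kill_self]; exact Subgroup.one_mem _
          · rw [kill_ne hdc]
            apply Subgroup.subset_closure
            refine ⟨d, ?_, rfl⟩
            simp only [Set.mem_union, Finset.coe_insert, Set.mem_insert_iff] at hd ⊢
            tauto
        exact this hx)
      exact ⟨y, hy, h1.trans h2⟩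

lemma exists_support (x : FreeGroup α) :
    ∃ S : Finset α, x ∈ Subgroup.closure (FreeGroup.of '' (S : Set α)) := by
  classical
  induction x using FreeGroup.induction_on with
  | C1 => exact ⟨∅, Subgroup.one_mem _⟩
  | of c => exact ⟨{c}, Subgroup.subset_closure ⟨c, by simp, rfl⟩⟩
  | inv_of c h =>
    obtain ⟨S, hS⟩ := h
    exact ⟨S, Subgroup.inv_mem _ hS⟩
  | mul x y hx hy =>
    obtain ⟨S, hS⟩ := hx
    obtain ⟨S', hS'⟩ := hy
    refine ⟨S ∪ S', Subgroup.mul_mem _ ?_ ?_⟩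
    · exact Subgroup.closure_mono (Set.image_mono (by simp)) hS
    · exact Subgroup.closure_mono (Set.image_mono (by simp)) hS'

lemma conj_closure {w x : FreeGroup α} (T : Set α)
    (hw : w ∈ Subgroup.closure (FreeGroup.of '' T)) (h : TC w x) :
    ∃ y ∈ Subgroup.closure (FreeGroup.of '' T), IsConj x y := by
  obtain ⟨S, hS⟩ := exists_support x
  exact conj_closure_aux T hw S x h
    (Subgroup.closure_mono (Set.image_mono Set.subset_union_right) hS)

end lists

/-! ### The two generator case -/

/-- The matrix of eigenvectors. -/
noncomputable def QQ (t : ℂ) : Matrix.SpecialLinearGroup (Fin 2) ℂ :=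
  ⟨!![t, -1; 1 - t, 1], by rw [Matrix.det_fin_two_of]; ring⟩

/-- The unit `2`. -/
noncomputable def two' : ℂˣ := Units.mk0 2 two_ne_zero

/-- All generators go to a conjugate of `diag(2, 1/2)`. -/
noncomputable def rQ (α : Type*) (Q : Matrix.SpecialLinearGroup (Fin 2) ℂ) :
    FreeGroup α →* Matrix.SpecialLinearGroup (Fin 2) ℂ :=
  FreeGroup.lift fun _ => Q * dg two' * Q⁻¹

lemma rQ_zpow {α : Type*} (Q : Matrix.SpecialLinearGroup (Fin 2) ℂ) (a : α) (e : ℤ) :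
    rQ α Q (FreeGroup.of a ^ e) = Q * dg (two' ^ e) * Q⁻¹ := by
  simp [rQ, conj_zpow]

lemma rQ_one_coe {α : Type*} (a : α) (e : ℤ) :
    (rQ α 1 (FreeGroup.of a ^ e)).1 = !![(2 : ℂ) ^ e, 0; 0, ((2 : ℂ) ^ e)⁻¹] := by
  rw [rQ_zpow, inv_one, one_mul, mul_one, dg_coe]
  simp [two']

lemma rQ_coe {α : Type*} (t : ℂ) (a : α) (e : ℤ) :
    (rQ α (QQ t) (FreeGroup.of a ^ e)).1 =
      !![t * 2 ^ e + (1 - t) * (2 ^ e)⁻¹, t * (2 ^ e - (2 ^ e)⁻¹);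
        (1 - t) * (2 ^ e - (2 ^ e)⁻¹), (1 - t) * 2 ^ e + t * (2 ^ e)⁻¹] := by
  have hinv : ((QQ t)⁻¹).1 = !![1, 1; -(1 - t), t] := by
    rw [Matrix.SpecialLinearGroup.SL2_inv_expl]
    ext i j
    fin_cases i <;> fin_cases j <;> simp [QQ]
  have hQ : (QQ t).1 = !![t, -1; 1 - t, 1] := rfl
  rw [rQ_zpow, Matrix.SpecialLinearGroup.coe_mul, Matrix.SpecialLinearGroup.coe_mul, hinv, hQ,
    dg_coe, Matrix.mul_fin_two, Matrix.mul_fin_two]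
  simp only [two', Units.val_zpow_eq_zpow_val, Units.val_mk0, Units.val_inv_eq_inv_val]
  ext i j
  fin_cases i <;> fin_cases j <;> simp <;> ring

lemma two_zpow_sq_inj {e j : ℤ} (h : ((2 : ℂ) ^ e) ^ 2 = ((2 : ℂ) ^ j) ^ 2) : e = j := by
  have h1 : ((2 : ℝ) ^ e) ^ 2 = ((2 : ℝ) ^ j) ^ 2 := by
    apply Complex.ofReal_injective
    push_cast
    exact h
  have h2 : (2 : ℝ) ^ e = 2 ^ j := by
    have p1 : (0 : ℝ) < 2 ^ e := by positivity
    have p2 : (0 : ℝ) < 2 ^ j := by positivity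
    exact (sq_eq_sq₀ p1.le p2.le).1 h1
  exact zpow_right_injective₀ (by norm_num) (by norm_num) h2

lemma two_zpow_sq_ne_one {e : ℤ} (he : e ≠ 0) : ((2 : ℂ) ^ e) ^ 2 ≠ 1 := by
  intro h
  apply he
  apply two_zpow_sq_inj
  simpa using h

lemma two_zpow_sq_ne_neg_one {e : ℤ} : ((2 : ℂ) ^ e) ^ 2 ≠ -1 := by
  intro h
  have h1 : ((2 : ℝ) ^ e) ^ 2 = -1 := by
    apply Complex.ofReal_injective
    push_cast
    exact h
  nlinarith [sq_nonneg ((2 : ℝ) ^ e)]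

lemma rQ_half {α : Type*} (a : α) (e : ℤ) (he : e ≠ 0) (i j : Fin 2) :
    (rQ α (QQ (1 / 2)) (FreeGroup.of a ^ e)).1 i j ≠ 0 := by
  rw [rQ_coe]
  have h1 := two_zpow_sq_ne_one he
  have h2 := two_zpow_sq_ne_neg_one (e := e)
  have h0 : (2 : ℂ) ^ e ≠ 0 := zpow_ne_zero _ two_ne_zero
  generalize (2 : ℂ) ^ e = x at *
  have hp : x + x⁻¹ ≠ 0 := by
    intro h
    apply h2
    have : x * (x + x⁻¹) = 0 := by rw [h, mul_zero]
    rw [mul_add, mul_inv_cancel₀ h0] at this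
    linear_combination this
  have hm : x - x⁻¹ ≠ 0 := by
    intro h
    apply h1
    have : x * (x - x⁻¹) = 0 := by rw [h, mul_zero]
    rw [mul_sub, mul_inv_cancel₀ h0] at this
    linear_combination this
  fin_cases i <;> fin_cases j
  · intro h; apply hp; simp at h; linear_combination 2 * h
  · intro h; apply hm; simp at h; linear_combination h
  · intro h; apply hm; norm_num at h; tauto
  · intro h; apply hp; simp at h; linear_combination 2 * h

lemma exists_t {α : Type*} (a : α) (e j : ℤ) (he : e ≠ 0) (s s' : Fin 2)
    (h : ∀ t : ℂ, (rQ α (QQ t) (FreeGroup.of a ^ e)).1 s s = 0 →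
      (rQ α (QQ t) (FreeGroup.of a ^ j)).1 s' s' = 0) :
    e = if s = s' then j else -j := by
  simp only [rQ_coe] at h
  have h1 := two_zpow_sq_ne_one he
  have h0 : (2 : ℂ) ^ e ≠ 0 := zpow_ne_zero _ two_ne_zero
  have h0' : (2 : ℂ) ^ j ≠ 0 := zpow_ne_zero _ two_ne_zero
  have goal1 : ((2 : ℂ) ^ e) ^ 2 = ((2 : ℂ) ^ j) ^ 2 → e = j := two_zpow_sq_inj
  have goal2 : ((2 : ℂ) ^ e) ^ 2 * ((2 : ℂ) ^ j) ^ 2 = 1 → e = -j := by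
    intro h
    apply two_zpow_sq_inj
    rw [zpow_neg, inv_pow]
    exact eq_inv_of_mul_eq_one_left h
  generalize (2 : ℂ) ^ e = x at *
  generalize (2 : ℂ) ^ j = y at *
  have hd : 1 - x ^ 2 ≠ 0 := fun h => h1 (by linear_combination -h)
  have hfin : ∀ i : Fin 2, i = 0 ∨ i = 1 := by decide
  rcases hfin s with rfl | rfl
  · have ht := h (1 / (1 - x ^ 2)) (by
      simp; field_simp; ring)
    rcases hfin s' with rfl | rfl
    · simp at ht ⊢
      apply goal1
      field_simp at ht
      linear_combination -ht
    · simp at ht ⊢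
      apply goal2
      field_simp at ht
      linear_combination -ht
  · have ht := h (1 - 1 / (1 - x ^ 2)) (by
      simp; field_simp; ring)
    rcases hfin s' with rfl | rfl
    · simp at ht ⊢
      apply goal2
      field_simp at ht
      linear_combination -ht
    · simp at ht ⊢
      apply goal1
      field_simp at ht
      linear_combination -ht

/-- The product of `a ^ e * b ^ q`. -/
def wz {G : Type*} [Group G] (a b : G) (K : List (ℤ × ℤ)) : G :=
  (K.map fun p => a ^ p.1 * b ^ p.2).prod

lemma wz_inv {G : Type*} [Group G] (a b : G) (K : List (ℤ × ℤ)) :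
    (wz a b K)⁻¹ = wz b a ((K.map fun p => (-p.2, -p.1)).reverse) := by
  unfold wz
  rw [List.prod_inv_reverse, List.map_reverse, List.map_map, List.map_map]
  congr 2
  apply List.map_congr_left
  intro p _
  simp

lemma main_lemma {α : Type*} {a b : α} (hab : a ≠ b) (j k : ℤ) (hj : j ≠ 0) (hk : k ≠ 0)
    (K : List (ℤ × ℤ)) (hK : K ≠ []) (hp : ∀ p ∈ K, p.1 ≠ 0 ∧ p.2 ≠ 0)
    (h : TC (FreeGroup.of a ^ j * FreeGroup.of b ^ k)
      (wz (FreeGroup.of a) (FreeGroup.of b) K)) :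
    ∃ s : Fin 2, ∀ p ∈ K, sg p.2 = s ∧ p.1 = if s = sg k then j else -j := by
  set L : List (FreeGroup α × ℤ) := K.map fun p => (FreeGroup.of a ^ p.1, p.2) with hLdef
  have hmem : ∀ p ∈ L, ∃ e : ℤ, e ≠ 0 ∧ p.1 = FreeGroup.of a ^ e ∧ p.2 ≠ 0 := by
    intro p hpL
    obtain ⟨p', h1, rfl⟩ := List.mem_map.1 hpL
    exact ⟨p'.1, (hp p' h1).1, rfl, (hp p' h1).2⟩
  have hL : L ≠ [] := by simpa [hLdef] using hK
  have hwp : wz (FreeGroup.of a) (FreeGroup.of b) K = wp (FreeGroup.of b) L := by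
    simp [wz, wp, hLdef, List.map_map, Function.comp_def]
  have haH : ∀ e : ℤ, FreeGroup.of a ^ e ∈ Hc b := fun e =>
    Subgroup.zpow_mem _ (of_mem_Hc hab) e
  have hLH : ∀ p ∈ L, p.1 ∈ Hc b := by
    intro p h
    obtain ⟨e, _, h1, _⟩ := hmem p h
    rw [h1]; exact haH e
  have hLq : ∀ p ∈ L, p.2 ≠ 0 := by
    intro p h
    obtain ⟨e, _, _, h1⟩ := hmem p h
    exact h1
  set W : List (FreeGroup α × ℤ) := [(FreeGroup.of a ^ j, k)] with hW
  have hww : FreeGroup.of a ^ j * FreeGroup.of b ^ k = wp (FreeGroup.of b) W := by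
    simp [wp, hW]
  obtain ⟨m, n, hm, hn, h⟩ := h
  rw [hww, hwp] at h
  have gx := fun ρ => growth_list ρ b L hL hLH hLq n hn
  have gw := fun ρ => growth_list ρ b W (by simp [hW]) (by simpa [hW] using haH j)
    (by simpa [hW] using hk) m hm
  have hcw : ∀ ρ, coef ρ (lst 0 W) W = (ρ (FreeGroup.of a ^ j)).1 (sg k) (sg k) := by
    intro ρ; simp [hW, coef, lst]
  have hN : wt W * m = wt L * n := by
    apply le_antisymm
    · refine growth_le (rQ α (QQ (1 / 2))) b _ _ _ _ _ _ (gw _) (gx _) h (pow_ne_zero _ ?_)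
      rw [hcw]
      exact rQ_half a j hj _ _
    · refine growth_le (rQ α (QQ (1 / 2))) b _ _ _ _ _ _ (gx _) (gw _) (fun ρ => (h ρ).symm)
        (pow_ne_zero _ (coef_ne_zero _ _ ?_ _))
      intro p hp
      obtain ⟨e, he, h1, _⟩ := hmem p hp
      rw [h1]
      exact rQ_half a e he
  have key : ∀ ρ : FreeGroup α →* Matrix.SpecialLinearGroup (Fin 2) ℂ,
      (ρ (FreeGroup.of a ^ j)).1 (sg k) (sg k) ≠ 0 → coef ρ (lst 0 L) L ≠ 0 := by
    intro ρ h1 h2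
    have h3 := growth_eq ρ b _ _ _ _ _ (hN ▸ gw ρ) (gx ρ) h
    rw [h2, zero_pow hn, hcw] at h3
    apply h1
    have h4 := pow_eq_zero_iff (two_ne_zero) |>.1 (h3.trans (zero_pow two_ne_zero))
    exact (pow_eq_zero_iff hm).1 h4
  have hfin : ∀ i : Fin 2, i = 0 ∨ i = 1 := by decide
  have hsg : ∀ p ∈ L, sg p.2 = lst 0 L := by
    refine coef_noflip (rQ α 1) L ?_ _ (key _ ?_)
    · intro p hp i j hij
      obtain ⟨e, he, h1, _⟩ := hmem p hp
      rw [h1, rQ_one_coe]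
      fin_cases i <;> fin_cases j <;> simp at hij ⊢
    · rw [rQ_one_coe]
      rcases hfin (sg k) with h | h <;> rw [h] <;> simp [zpow_ne_zero]
  refine ⟨lst 0 L, fun p hpK => ?_⟩
  have hpL : (FreeGroup.of a ^ p.1, p.2) ∈ L := List.mem_map.2 ⟨p, hpK, rfl⟩
  refine ⟨hsg _ hpL, ?_⟩
  refine exists_t a p.1 j (hp p hpK).1 (lst 0 L) (sg k) ?_
  intro t ht
  by_contra hne
  exact coef_entry (rQ α (QQ t)) L (lst 0 L) hsg (key _ hne) _ hpL ht

lemma sg_neg (q : ℤ) (hq : q ≠ 0) : sg (-q) ≠ sg q := by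
  unfold sg
  split_ifs <;> first | omega | decide

lemma wz_const {G : Type*} [Group G] (a b : G) (K : List (ℤ × ℤ)) (e q : ℤ)
    (h : ∀ p ∈ K, p.1 = e ∧ p.2 = q) : wz a b K = (a ^ e * b ^ q) ^ K.length := by
  unfold wz
  rw [List.prod_eq_pow_card _ (a ^ e * b ^ q), List.length_map]
  intro x hx
  obtain ⟨p, hp, rfl⟩ := List.mem_map.1 hx
  rw [(h p hp).1, (h p hp).2]

lemma two_gen {α : Type*} {a b : α} (hab : a ≠ b) (j k : ℤ) (hj : j ≠ 0) (hk : k ≠ 0)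
    (K : List (ℤ × ℤ)) (hK : K ≠ []) (hp : ∀ p ∈ K, p.1 ≠ 0 ∧ p.2 ≠ 0)
    (h : TC (FreeGroup.of a ^ j * FreeGroup.of b ^ k)
      (wz (FreeGroup.of a) (FreeGroup.of b) K)) :
    ∃ n : ℤ, n ≠ 0 ∧ IsConj ((FreeGroup.of a ^ j * FreeGroup.of b ^ k) ^ n)
      (wz (FreeGroup.of a) (FreeGroup.of b) K) := by
  obtain ⟨s, hs⟩ := main_lemma hab j k hj hk K hK hp h
  have h' := h.inv
  rw [wz_inv, mul_inv_rev, ← zpow_neg, ← zpow_neg] at h'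
  obtain ⟨s', hs'⟩ := main_lemma hab.symm (-k) (-j) (neg_ne_zero.2 hk) (neg_ne_zero.2 hj) _
    (by simpa using hK) (by
      intro p hpK
      rw [List.mem_reverse] at hpK
      obtain ⟨p', h1, rfl⟩ := List.mem_map.1 hpK
      have := hp p' h1
      simp only [ne_eq, neg_eq_zero]
      exact ⟨this.2, this.1⟩) h'
  have hs2 : ∀ p ∈ K, sg (-p.1) = s' ∧ -p.2 = if s' = sg (-j) then -k else - -k := by
    intro p hpK
    exact hs' (-p.2, -p.1) (by
      rw [List.mem_reverse]
      exact List.mem_map.2 ⟨p, hpK, rfl⟩)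
  have hlen : (K.length : ℤ) ≠ 0 := by
    simpa using hK
  by_cases hsk : s = sg k
  · refine ⟨K.length, hlen, ?_⟩
    rw [wz_const _ _ K j k, zpow_natCast]
    intro p hpK
    have h1 := hs p hpK
    have h2 := hs2 p hpK
    rw [if_pos hsk] at h1
    rw [h1.2] at h2
    rw [if_pos h2.1.symm] at h2
    exact ⟨h1.2, by omega⟩
  · refine ⟨-K.length, neg_ne_zero.2 hlen, ?_⟩
    rw [wz_const _ _ K (-j) (-k), zpow_neg, zpow_natCast, ← inv_pow, mul_inv_rev, ← zpow_neg,
      ← zpow_neg]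
    · exact (isConj_mul_comm _ _).pow _
    intro p hpK
    have h1 := hs p hpK
    have h2 := hs2 p hpK
    rw [if_neg hsk] at h1
    rw [h1.2, neg_neg] at h2
    rw [if_neg (by rw [← h2.1]; exact (sg_neg j hj).symm)] at h2
    exact ⟨h1.2, by omega⟩

lemma exists_K {α : Type*} (a : α) (L : List (FreeGroup α × ℤ))
    (hL : ∀ p ∈ L, p.1 ∈ Subgroup.zpowers (FreeGroup.of a) ∧ p.1 ≠ 1 ∧ p.2 ≠ 0) :
    ∃ K : List (ℤ × ℤ), (∀ p ∈ K, p.1 ≠ 0 ∧ p.2 ≠ 0) ∧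
      L = K.map fun p => (FreeGroup.of a ^ p.1, p.2) := by
  induction L with
  | nil => exact ⟨[], by simp, rfl⟩
  | cons p L ih =>
    obtain ⟨K, h1, rfl⟩ := ih (fun p hp => hL p (List.mem_cons_of_mem _ hp))
    obtain ⟨h2, h3, h4⟩ := hL p List.mem_cons_self
    obtain ⟨e, he⟩ := Subgroup.mem_zpowers_iff.1 h2
    refine ⟨(e, p.2) :: K, ?_, ?_⟩
    · intro p' hp'
      rcases List.mem_cons.1 hp' with rfl | hp'
      · refine ⟨?_, h4⟩
        rintro h0
        change e = 0 at h0
        rw [h0, zpow_zero] at he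
        exact h3 he.symm
      · exact h1 p' hp'
    · rw [List.map_cons]
      congr 1
      exact Prod.ext he.symm rfl

lemma of_zpow_eq_one {α : Type*} (a : α) (e : ℤ) (h : FreeGroup.of a ^ e = 1) : e = 0 := by
  have h1 := congrArg (FreeGroup.lift fun _ : α => Multiplicative.ofAdd (1 : ℤ)) h
  rw [map_zpow, FreeGroup.lift_apply_of, MonoidHom.map_one] at h1
  have h2 := congrArg Multiplicative.toAdd h1
  simpa using h2

lemma of_mem_cl {α : Type*} {T : Set α} {d : α} (h : d ∈ T) :
    FreeGroup.of d ∈ Subgroup.closure (FreeGroup.of '' T) :=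
  Subgroup.subset_closure ⟨d, h, rfl⟩

/-- The case of a power of a generator. -/
lemma one_gen {α : Type*} (g : α) (k : ℤ) (x : FreeGroup α) (h : TC (FreeGroup.of g ^ k) x) :
    ∃ m' n' : ℤ, m' ≠ 0 ∧ n' ≠ 0 ∧ IsConj ((FreeGroup.of g ^ k) ^ m') (x ^ n') := by
  obtain ⟨y, hy, hxy⟩ := conj_closure {g} (Subgroup.zpow_mem _
    (of_mem_cl (by simp)) k) h
  rw [Set.image_singleton, ← Subgroup.zpowers_eq_closure] at hy
  obtain ⟨q, rfl⟩ := Subgroup.mem_zpowers_iff.1 hy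
  have h' := h.conj hxy
  by_cases hk : k = 0
  · have h1 := conj_kill g (by rw [hk, zpow_zero]; exact Subgroup.one_mem _) h'
    rw [map_zpow, kill_self, one_zpow] at h1
    refine ⟨1, 1, one_ne_zero, one_ne_zero, ?_⟩
    rw [hk, zpow_zero, one_zpow, zpow_one]
    exact (hxy.trans h1).symm
  by_cases hq : q = 0
  · exfalso
    have h1 := conj_kill g (by rw [hq, zpow_zero]; exact Subgroup.one_mem _) h'.symm
    rw [map_zpow, kill_self, one_zpow, isConj_one_left] at h1
    exact hk (of_zpow_eq_one g k h1)
  refine ⟨q, k, hq, hk, ?_⟩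
  obtain ⟨c, hc⟩ := isConj_iff.1 hxy.symm
  rw [isConj_iff]
  refine ⟨c, ?_⟩
  rw [← hc, conj_zpow, ← zpow_mul, ← zpow_mul, mul_comm]

lemma not_conj {α : Type*} {a b : α} (hab : a ≠ b) (j k : ℤ)
    (h : IsConj (FreeGroup.of a ^ j * FreeGroup.of b ^ k) (FreeGroup.of a ^ j)) : k = 0 := by
  classical
  have h1 := (FreeGroup.lift fun d : α => Multiplicative.ofAdd (if d = b then (1 : ℤ) else 0)).map_isConj h
  rw [isConj_iff_eq, map_mul, map_zpow, map_zpow, FreeGroup.lift_apply_of,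
    FreeGroup.lift_apply_of] at h1
  have h2 := congrArg Multiplicative.toAdd h1
  simpa [hab] using h2

lemma main_nat {α : Type*} {a b : α} (hab : a ≠ b) (j k : ℤ) (x : FreeGroup α)
    (h : TC (FreeGroup.of a ^ j * FreeGroup.of b ^ k) x) :
    ∃ m' n' : ℤ, m' ≠ 0 ∧ n' ≠ 0 ∧
      IsConj ((FreeGroup.of a ^ j * FreeGroup.of b ^ k) ^ m') (x ^ n') := by
  by_cases hj : j = 0
  · rw [hj, zpow_zero, one_mul] at h ⊢
    exact one_gen b k x h
  by_cases hk : k = 0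
  · rw [hk, zpow_zero, mul_one] at h ⊢
    exact one_gen a j x h
  obtain ⟨y, hy, hxy⟩ := conj_closure {a, b} (Subgroup.mul_mem _ (Subgroup.zpow_mem _
    (of_mem_cl (by simp)) j) (Subgroup.zpow_mem _
    (of_mem_cl (by simp)) k)) h
  have hy' : y ∈ Subgroup.closure
      ((Subgroup.zpowers (FreeGroup.of a) : Set (FreeGroup α)) ∪ {FreeGroup.of b}) := by
    refine Subgroup.closure_mono ?_ hy
    rintro _ ⟨d, hd, rfl⟩
    rcases hd with rfl | rfl
    · left; exact Subgroup.mem_zpowers _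
    · right; rfl
  rcases normal_form _ _ y hy' with ⟨g, hg, hx⟩ | ⟨q, hq, hx⟩ | ⟨L, hL, hp, hx⟩
  · exfalso
    obtain ⟨e, rfl⟩ := Subgroup.mem_zpowers_iff.1 hg
    have h1 := conj_kill b (Subgroup.zpow_mem _ (of_mem_Hc hab) e) ((h.conj hxy).conj hx).symm
    rw [map_mul, map_zpow, map_zpow, kill_self, kill_ne hab, one_zpow, mul_one] at h1
    exact hk (not_conj hab j k h1)
  · exfalso
    have h1 := conj_kill a (Subgroup.zpow_mem _ (of_mem_Hc hab.symm) q)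
      ((h.conj hxy).conj hx).symm
    rw [map_mul, map_zpow, map_zpow, kill_self, kill_ne hab.symm, one_zpow, one_mul] at h1
    exact hj (not_conj hab.symm k j ((isConj_mul_comm _ _).trans h1))
  · obtain ⟨K, hK, rfl⟩ := exists_K a L hp
    have hwz : wp (FreeGroup.of b) (K.map fun p => (FreeGroup.of a ^ p.1, p.2)) =
        wz (FreeGroup.of a) (FreeGroup.of b) K := by
      simp [wz, wp, List.map_map, Function.comp_def]
    rw [hwz] at hx
    obtain ⟨n, hn, hc⟩ := two_gen hab j k hj hk K (by simpa using hL) hK ((h.conj hxy).conj hx)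
    refine ⟨n, 1, hn, one_ne_zero, ?_⟩
    rw [zpow_one]
    exact hc.trans (hxy.trans hx).symm

end TraceTwins

/-- **No trace twins for `a^j b^k` in a free group.** Let `a ≠ b` in `α`, let `F` be the free
group on `α`, and let `w = (of a)^j * (of b)^k`. If `x ∈ F` is trace-commensurable with `w`
(i.e. there are nonzero integers `m`, `n` with `(tr ρ(w^m))² = (tr ρ(x^n))²` for every
representation `ρ : F →* SL₂(ℂ)`), then some nonzero power of `w` is conjugate in `F` to
some nonzero power of `x`. -/
theorem freeGroup_pow_mul_pow_no_trace_twins {α : Type*} {a b : α} (hab : a ≠ b)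
    (j k : ℤ) (w : FreeGroup α) (hw : w = FreeGroup.of a ^ j * FreeGroup.of b ^ k)
    (x : FreeGroup α)
    (h : ∃ m n : ℤ, m ≠ 0 ∧ n ≠ 0 ∧
      ∀ ρ : FreeGroup α →* Matrix.SpecialLinearGroup (Fin 2) ℂ,
        (Matrix.trace ((ρ (w ^ m) : Matrix (Fin 2) (Fin 2) ℂ))) ^ 2 =
        (Matrix.trace ((ρ (x ^ n) : Matrix (Fin 2) (Fin 2) ℂ))) ^ 2) :
    ∃ m' n' : ℤ, m' ≠ 0 ∧ n' ≠ 0 ∧ IsConj (w ^ m') (x ^ n') := by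
  subst hw
  obtain ⟨m, n, hm, hn, h⟩ := h
  refine TraceTwins.main_nat hab j k x ⟨m.natAbs, n.natAbs, by simpa using hm, by simpa using hn,
    fun ρ => ?_⟩
  rw [← TraceTwins.trace_zpow, ← TraceTwins.trace_zpow]
  exact h ρ
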